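/- Let k ≥ 4. The square ξ^k(0)ξ^k(0) is always followed by 0′ in u_k: for every letter a ∈ A, if ξ^k(0)ξ^k(0)a is a factor of u_k, then a = 0′. -/

import Mathlib

open List Filter Topology

/-- The alphabet `A`: the letter `(b, j)` is the unprimed letter `j` if `b = false`
and the primed letter `j′` if `b = true`.  Only letters with `j < k` occur. -/
abbrev Letter : Type := Bool × ℕ

/-- The morphism ξ_k on letters: `0 ↦ 01`, `j ↦ j+1` for `1 ≤ j ≤ k−2`, `k−1 ↦ 0′`,
and symmetrically on primed letters with `(k−1)′ ↦ 0`. -/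
def xiL (k : ℕ) (a : Letter) : List Letter :=
  if a.2 = 0 then [(a.1, 0), (a.1, 1)]
  else if a.2 = k - 1 then [(!a.1, 0)]
  else [(a.1, a.2 + 1)]

/-- The morphism ξ_k on finite words. -/
def xiW (k : ℕ) (w : List Letter) : List Letter := w.flatMap (xiL k)

/-- The word ξ_k^n(0). -/
def xiPow (k n : ℕ) : List Letter := (xiW k)^[n] [((false : Bool), (0 : ℕ))]

/-- The projection π : A → {0,1}, with `false` playing the role of `0` and
`true` the role of `1`. -/
def proj (a : Letter) : Bool := if a.2 = 0 then a.1 else !a.1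

/-- The twin map `ℓ ↔ ℓ′` on letters. -/
def twin (a : Letter) : Letter := (!a.1, a.2)

/-- The finite word `w` occurs in the infinite word `v` at position `j`. -/
def OccursAt {α : Type*} (w : List α) (v : ℕ → α) (j : ℕ) : Prop :=
  ∀ i, i < w.length → w[i]? = some (v (j + i))

/-- The finite word `w` is a prefix of the infinite word `v`. -/
def PrefixSeq {α : Type*} (w : List α) (v : ℕ → α) : Prop := OccursAt w v 0

/-- The finite word `w` is a factor of the infinite word `v`. -/
def FactorOf {α : Type*} (w : List α) (v : ℕ → α) : Prop := ∃ j, OccursAt w v j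

/-- `v` is the fixed point `u_k = ξ_k^ω(0)`: every `ξ_k^n(0)` is a prefix of `v`. -/
def IsFixedPoint (k : ℕ) (v : ℕ → Letter) : Prop := ∀ n, PrefixSeq (xiPow k n) v

/-- `q ≥ 1` is a period of the finite word `z`. -/
def HasPeriod {α : Type*} (z : List α) (q : ℕ) : Prop :=
  1 ≤ q ∧ ∀ i, i + q < z.length → z[i]? = z[i + q]?

/-- `w` is a left special factor of the infinite word `v`. -/
def LeftSpecial {α : Type*} (w : List α) (v : ℕ → α) : Prop :=
  ∃ a b : α, a ≠ b ∧ FactorOf (a :: w) v ∧ FactorOf (b :: w) v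

/-- `w` is a right special factor of the infinite word `v`. -/
def RightSpecial {α : Type*} (w : List α) (v : ℕ → α) : Prop :=
  ∃ a b : α, a ≠ b ∧ FactorOf (w ++ [a]) v ∧ FactorOf (w ++ [b]) v

/-- `w` is a bispecial factor of the infinite word `v`. -/
def Bispecial {α : Type*} (w : List α) (v : ℕ → α) : Prop :=
  LeftSpecial w v ∧ RightSpecial w v

/-- The set of left extensions of `w` in `v`. -/
def Lext {α : Type*} (w : List α) (v : ℕ → α) : Set α := {a | FactorOf (a :: w) v}

/-- The set of right extensions of `w` in `v`. -/
def Rext {α : Type*} (w : List α) (v : ℕ → α) : Set α := {a | FactorOf (w ++ [a]) v}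

/-- `r` is a return word to `w` in `v`: it spans two consecutive occurrences of `w`. -/
def ReturnWordTo {α : Type*} (r w : List α) (v : ℕ → α) : Prop :=
  ∃ j ℓ, j < ℓ ∧ OccursAt w v j ∧ OccursAt w v ℓ ∧
    (∀ m, j < m → m < ℓ → ¬ OccursAt w v m) ∧
    r = (List.range (ℓ - j)).map (fun i => v (j + i))

/-- The factor complexity of an infinite word. -/
noncomputable def complexity {α : Type*} (v : ℕ → α) (n : ℕ) : ℕ :=
  {w : List α | w.length = n ∧ FactorOf w v}.ncard

/-- `f` locates the blocks of `u = ξ_k(u)`: the image `ξ_k(u n)` occupies the positions of `u`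
from `f n` up to (but excluding) `f (n + 1)`. -/
structure IsCutting (k : ℕ) (u : ℕ → Letter) (f : ℕ → ℕ) : Prop where
  zero : f 0 = 0
  succ : ∀ n, f (n + 1) = f n + (xiL k (u n)).length
  occurs : ∀ n, OccursAt (xiL k (u n)) u (f n)

theorem length_le_length_xiW (k : ℕ) (w : List Letter) : w.length ≤ (xiW k w).length := by
  induction w with
  | nil => simp
  | cons a w ih =>
    have h : 1 ≤ (xiL k a).length := by unfold xiL; split_ifs <;> simp
    simp only [xiW, List.flatMap_cons, List.length_append, List.length_cons] at ih ⊢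
    omega

theorem xiPow_succ (k n : ℕ) : xiPow k (n + 1) = xiW k (xiPow k n) :=
  Function.iterate_succ_apply' _ _ _

theorem exists_xiPow_eq_cons (k n : ℕ) :
    ∃ t, xiPow k n = ((false : Bool), (0 : ℕ)) :: t ∧ n ≤ t.length := by
  induction n with
  | zero => exact ⟨[], rfl, le_rfl⟩
  | succ n ih =>
    obtain ⟨t, ht, hn⟩ := ih
    refine ⟨(false, 1) :: xiW k t, ?_, ?_⟩
    · rw [xiPow_succ, ht]
      simp [xiW, xiL]
    · have := length_le_length_xiW k t
      simp only [List.length_cons]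
      omega

theorem IsFixedPoint.exists_isCutting {k : ℕ} {u : ℕ → Letter} (hu : IsFixedPoint k u) :
    ∃ f, IsCutting k u f := by
  let p : ℕ → List Letter := fun n => (List.range n).map u
  have hp : ∀ n, p (n + 1) = p n ++ [u n] := fun n => by simp [p, List.range_succ]
  have hW : ∀ n, xiW k (p (n + 1)) = xiW k (p n) ++ xiL k (u n) := fun n => by
    rw [hp]; simp [xiW]
  refine ⟨fun n => (xiW k (p n)).length, by simp [p, xiW], fun n => by simp [hW], ?_⟩
  intro n i hi
  obtain ⟨t, ht, hn⟩ := exists_xiPow_eq_cons k n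
  have hlen : n + 1 ≤ (xiPow k n).length := by rw [ht]; simpa using hn
  have hpre : p (n + 1) <+: xiPow k n := by
    rw [List.prefix_iff_eq_take]
    apply List.ext_getElem?
    intro m
    by_cases hm : m < n + 1
    · have := hu n m (by omega)
      simp only [zero_add] at this
      simp [p, hm, this]
    · simp [p, hm]
  obtain ⟨s, hs⟩ := hpre
  have hx : xiPow k (n + 1) = xiW k (p n) ++ xiL k (u n) ++ xiW k s := by
    rw [xiPow_succ, ← hs, ← hW]
    simp [xiW]
  have := hu (n + 1) ((xiW k (p n)).length + i) (by rw [hx]; simp; omega)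
  rw [hx, List.append_assoc, List.getElem?_append_right (by omega),
    List.getElem?_append_left (by omega)] at this
  simpa using this

namespace IsCutting

variable {k : ℕ} {u : ℕ → Letter} {f : ℕ → ℕ} {b c : Bool} {i j l m n : ℕ}

theorem of_zero (hf : IsCutting k u f) (h : u n = (b, 0)) :
    u (f n) = (b, 0) ∧ u (f n + 1) = (b, 1) ∧ f (n + 1) = f n + 2 := by
  have h0 := hf.occurs n 0
  have h1 := hf.occurs n 1
  have h2 := hf.succ n
  simp [h, xiL] at h0 h1 h2
  exact ⟨h0.symm, h1.symm, h2⟩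

theorem of_last (hf : IsCutting k u f) (hk : 2 ≤ k) (h : u n = (b, k - 1)) :
    u (f n) = (!b, 0) ∧ f (n + 1) = f n + 1 := by
  have h0 := hf.occurs n 0
  have h2 := hf.succ n
  have hk' : k - 1 ≠ 0 := by omega
  simp [h, xiL, hk'] at h0 h2
  exact ⟨h0.symm, h2⟩

theorem of_middle (hf : IsCutting k u f) (hj : j ≠ 0) (hjk : j ≠ k - 1) (h : u n = (b, j)) :
    u (f n) = (b, j + 1) ∧ f (n + 1) = f n + 1 := by
  have h0 := hf.occurs n 0
  have h2 := hf.succ n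
  simp [h, xiL, hj, hjk] at h0 h2
  exact ⟨h0.symm, h2⟩

theorem strictMono (hf : IsCutting k u f) : StrictMono f := by
  refine strictMono_nat_of_lt_succ fun n => ?_
  have h : 1 ≤ (xiL k (u n)).length := by unfold xiL; split_ifs <;> simp
  have := hf.succ n
  omega

theorem exists_index (hf : IsCutting k u f) (i : ℕ) :
    ∃ n, i = f n ∨ i = f n + 1 ∧ (u n).2 = 0 := by
  induction i with
  | zero => exact ⟨0, Or.inl hf.zero.symm⟩
  | succ i ih =>
    obtain ⟨n, rfl | ⟨rfl, h⟩⟩ := ih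
    · by_cases h : (u n).2 = 0
      · exact ⟨n, Or.inr ⟨rfl, h⟩⟩
      · refine ⟨n + 1, Or.inl ?_⟩
        rw [hf.succ]
        unfold xiL
        split_ifs <;> simp
    · exact ⟨n + 1, Or.inl (hf.of_zero (b := (u n).1) (Prod.ext rfl h)).2.2.symm⟩

theorem exists_block (hf : IsCutting k u f) (hk : 2 ≤ k) (i : ℕ) :
    ∃ n b, (i = f n ∧ u n = (b, 0) ∧ u i = (b, 0) ∧ u (i + 1) = (b, 1)) ∨
      (i = f n + 1 ∧ u n = (b, 0) ∧ u i = (b, 1) ∧ f (n + 1) = i + 1) ∨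
      (i = f n ∧ u n = (b, k - 1) ∧ u i = (!b, 0) ∧ f (n + 1) = i + 1) ∨
      (i = f n ∧ ∃ j, j ≠ 0 ∧ u n = (b, j) ∧ u i = (b, j + 1) ∧ f (n + 1) = i + 1) := by
  obtain ⟨n, hn⟩ := hf.exists_index i
  obtain ⟨b, j, h⟩ : ∃ b j, u n = (b, j) := ⟨_, _, rfl⟩
  refine ⟨n, b, ?_⟩
  obtain rfl | ⟨rfl, h0⟩ := hn
  · by_cases h0 : j = 0
    · subst h0
      obtain ⟨h1, h2, -⟩ := hf.of_zero h
      exact Or.inl ⟨rfl, h, h1, h2⟩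
    by_cases h1 : j = k - 1
    · subst h1
      exact Or.inr (Or.inr (Or.inl ⟨rfl, h, hf.of_last hk h⟩))
    · exact Or.inr (Or.inr (Or.inr ⟨rfl, j, h0, h, hf.of_middle h0 h1 h⟩))
  · rw [h] at h0
    obtain rfl : j = 0 := h0
    obtain ⟨-, h1, h2⟩ := hf.of_zero h
    exact Or.inr (Or.inl ⟨rfl, h, h1, h2⟩)

theorem eq_of_zero (hf : IsCutting k u f) (hk : 2 ≤ k) (h : u i = (b, 0)) :
    ∃ n, i = f n ∧ ((u n = (b, 0) ∧ u (i + 1) = (b, 1)) ∨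
      (u n = (!b, k - 1) ∧ f (n + 1) = i + 1)) := by
  obtain ⟨n, c, hb⟩ := hf.exists_block hk i
  refine ⟨n, ?_⟩
  cases b <;> cases c <;> grind

theorem eq_of_one (hf : IsCutting k u f) (hk : 2 ≤ k) (h : u i = (b, 1)) :
    ∃ n, i = f n + 1 ∧ u n = (b, 0) ∧ f (n + 1) = i + 1 := by
  obtain ⟨n, c, hb⟩ := hf.exists_block hk i
  refine ⟨n, ?_⟩
  cases b <;> cases c <;> grind

theorem eq_of_two_le (hf : IsCutting k u f) (hk : 2 ≤ k) (h : u i = (b, j + 2)) :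
    ∃ n, i = f n ∧ u n = (b, j + 1) ∧ f (n + 1) = i + 1 := by
  obtain ⟨n, c, hb⟩ := hf.exists_block hk i
  refine ⟨n, ?_⟩
  cases b <;> cases c <;> grind

/-- A nonzero letter is preceded by its predecessor. -/
theorem eq_pred (hf : IsCutting k u f) (hk : 2 ≤ k) (hl : l + 1 < k)
    (h : u (i + 1) = (c, l + 1)) : u i = (c, l) := by
  induction l generalizing i with
  | zero =>
    obtain ⟨n, hn, h0, -⟩ := hf.eq_of_one hk h
    obtain rfl : i = f n := by omega
    exact (hf.of_zero h0).1
  | succ l ih =>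
    obtain ⟨n, hn, h1, -⟩ := hf.eq_of_two_le hk h
    obtain _ | n := n
    · have := hf.zero
      omega
    have hp := ih (by omega) h1
    obtain rfl | hl0 := Nat.eq_zero_or_pos l
    · obtain ⟨-, h2, h3⟩ := hf.of_zero hp
      rwa [show i = f n + 1 by omega]
    · obtain ⟨h2, h3⟩ := hf.of_middle (by omega) (by omega) hp
      rwa [show i = f n by omega]

/-- Desubstitution of an increasing run `0 1 ⋯ m`, with `m ≥ 1`. -/
theorem exists_run (hf : IsCutting k u f) (hk : 2 ≤ k) (m : ℕ)
    (h : ∀ t ≤ m + 1, u (i + t) = (b, t)) :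
    ∃ n, i = f n ∧ (∀ t ≤ m, u (n + t) = (b, t)) ∧ f (n + (m + 1)) = i + (m + 2) := by
  induction m with
  | zero =>
    obtain ⟨n, hn, h0, hs⟩ := hf.eq_of_one hk (h 1 le_rfl)
    refine ⟨n, by omega, ?_, by simpa using hs⟩
    intro t ht
    obtain rfl : t = 0 := by omega
    exact h0
  | succ m ih =>
    obtain ⟨n, hn, hr, hs⟩ := ih fun t ht => h t (by omega)
    obtain ⟨n', hn', h1, hs'⟩ := hf.eq_of_two_le hk (h (m + 2) le_rfl)
    obtain rfl : n' = n + (m + 1) := hf.strictMono.injective (by omega)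
    refine ⟨n, hn, ?_, by rw [← add_assoc n, hs']; omega⟩
    intro t ht
    obtain rfl | ht := Nat.eq_or_lt_of_le ht
    · exact h1
    · exact hr t (by omega)

/-- The word `0 1 ⋯ (m+1) 0 1 ⋯ m 0′` does not occur in `u`. -/
theorem not_runs_twin_zero (hf : IsCutting k u f) (hk : 3 ≤ k) (hm : m + 1 < k)
    (h₁ : ∀ t ≤ m + 1, u (i + t) = (b, t)) (h₂ : ∀ t ≤ m, u (i + (m + 2) + t) = (b, t)) :
    u (i + (m + 2) + (m + 1)) ≠ (!b, 0) := by
  induction m generalizing i with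
  | zero =>
    intro h₃
    obtain ⟨n, -, hr, hs⟩ := hf.exists_run (by omega) 0 h₁
    obtain ⟨n', hn', hz⟩ := hf.eq_of_zero (by omega) (h₂ 0 le_rfl)
    obtain rfl : n' = n + 1 := hf.strictMono.injective (by simpa [← hn'] using hs.symm)
    obtain ⟨-, h1⟩ | ⟨h1, -⟩ := hz
    · simpa using h1.symm.trans h₃
    · have h0 := hf.eq_pred (l := k - 2) (by omega) (by omega)
        (by rw [h1, show k - 1 = k - 2 + 1 by omega])
      simpa [h0] using hr 0 le_rfl
  | succ m ih =>
    intro h₃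
    obtain ⟨n, -, hr, hs⟩ := hf.exists_run (by omega) (m + 1) h₁
    obtain ⟨n', hn', hr', hs'⟩ := hf.exists_run (by omega) m h₂
    obtain rfl : n' = n + (m + 2) := hf.strictMono.injective (by rw [hs]; omega)
    obtain ⟨q, hq, hz⟩ := hf.eq_of_zero (by omega) h₃
    obtain rfl : q = n + (m + 2) + (m + 1) := hf.strictMono.injective (by rw [hs']; omega)
    obtain ⟨h1, -⟩ | ⟨h1, -⟩ := hz
    · exact ih (by omega) hr hr' h1
    · have h0 := hf.eq_pred (l := k - 2) (i := n + (m + 2) + m) (by omega) (by omega)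
        (by rw [add_assoc _ m, h1, show k - 1 = k - 2 + 1 by omega])
      have h2 := hr' m le_rfl
      rw [h0, Prod.mk.injEq] at h2
      omega

/-- The word `0 1 ⋯ m 0 1 ⋯ m 0` does not occur in `u`. -/
theorem not_runs_zero (hf : IsCutting k u f) (hk : 3 ≤ k) (hm : m < k)
    (h₁ : ∀ t ≤ m, u (i + t) = (b, t)) (h₂ : ∀ t ≤ m, u (i + (m + 1) + t) = (b, t)) :
    u (i + (m + 1) + (m + 1)) ≠ (b, 0) := by
  induction m generalizing i with
  | zero =>
    intro h₃
    have h1 := h₂ 0 le_rfl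
    obtain ⟨n, hn, ⟨-, hz⟩ | ⟨hz, hs⟩⟩ := hf.eq_of_zero (by omega) (h₁ 0 le_rfl)
    · simp_all
    obtain ⟨n', hn', ⟨-, hz'⟩ | ⟨hz', -⟩⟩ := hf.eq_of_zero (by omega) h1
    · simp_all
    obtain rfl : n' = n + 1 := hf.strictMono.injective (by rw [hs, ← hn'])
    have h0 := hf.eq_pred (l := k - 2) (by omega) (by omega)
      (by rw [hz', show k - 1 = k - 2 + 1 by omega])
    rw [h0, Prod.mk.injEq] at hz
    omega
  | succ m ih =>
    intro h₃
    obtain ⟨n, -, hr, hs⟩ := hf.exists_run (by omega) m h₁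
    obtain ⟨n', hn', hr', hs'⟩ := hf.exists_run (by omega) m h₂
    obtain rfl : n' = n + (m + 1) := hf.strictMono.injective (by rw [hs]; omega)
    obtain ⟨q, hq, hz⟩ := hf.eq_of_zero (by omega) h₃
    obtain rfl : q = n + (m + 1) + (m + 1) := hf.strictMono.injective (by rw [hs']; omega)
    obtain ⟨h1, -⟩ | ⟨h1, -⟩ := hz
    · exact ih (by omega) hr hr' h1
    · have h0 := hf.eq_pred (l := k - 2) (i := n + (m + 1) + m) (by omega) (by omega)
        (by rw [add_assoc _ m, h1, show k - 1 = k - 2 + 1 by omega])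
      have h2 := hr' m le_rfl
      simp [h0] at h2

end IsCutting

theorem xiPow_succ_eq_append {k n : ℕ} (h : n + 1 < k) :
    xiPow k (n + 1) = xiPow k n ++ [((false : Bool), n + 1)] := by
  induction n with
  | zero => rfl
  | succ n ih =>
    conv_lhs => rw [xiPow_succ, ih (by omega)]
    rw [xiPow_succ k n]
    simp [xiW, xiL, show n + 1 ≠ k - 1 by omega]

theorem xiPow_eq_map_range {k n : ℕ} (h : n < k) :
    xiPow k n = (List.range (n + 1)).map (fun j => ((false : Bool), j)) := by
  induction n with
  | zero => rfl
  | succ n ih => rw [xiPow_succ_eq_append h, ih (by omega), List.range_succ (n := n + 1)]; simp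

theorem xiPow_self {k : ℕ} (hk : 2 ≤ k) :
    xiPow k k = (List.range k).map (fun j => ((false : Bool), j)) ++ [(true, 0)] := by
  obtain ⟨k, rfl⟩ := Nat.exists_eq_add_of_le' hk
  rw [xiPow_succ (k + 2) (k + 1), xiPow_succ_eq_append (by omega)]
  have h := xiPow_succ (k + 2) k
  rw [xiPow_eq_map_range (n := k + 1) (by omega)] at h
  rw [h]
  simp [xiW, xiL]

theorem FactorOf.exists_forall_square {k : ℕ} (hk : 2 ≤ k) {u : ℕ → Letter} {a : Letter}
    (h : FactorOf (xiPow k k ++ xiPow k k ++ [a]) u) :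
    ∃ j, (∀ t < k, u (j + t) = (false, t)) ∧ u (j + k) = (true, 0) ∧
      (∀ t < k, u (j + (k + 1) + t) = (false, t)) ∧ u (j + (k + 1) + k) = (true, 0) ∧
      u (j + (k + 1) + (k + 1)) = a := by
  obtain ⟨j, hj⟩ := h
  rw [xiPow_self hk] at hj
  refine ⟨j, fun t ht => ?_, ?_, fun t ht => ?_, ?_, ?_⟩
  · have := hj t (by simp; omega)
    grind
  · have := hj k (by simp)
    grind
  · have := hj (k + 1 + t) (by simp; omega)
    grind
  · have := hj (k + 1 + k) (by simp; omega)
    grind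
  · have := hj (k + 1 + (k + 1)) (by simp; omega)
    grind

/-- for `k ≥ 4`, the square `ξ^k(0)ξ^k(0)` is always followed by `0′`
in `u_k`. -/
theorem stmt_9 (k : ℕ) (hk : 4 ≤ k) (u : ℕ → Letter) (hu : IsFixedPoint k u) :
    ∀ a : Letter, a.2 < k →
      FactorOf (xiPow k k ++ xiPow k k ++ [a]) u → a = ((true : Bool), (0 : ℕ)) := by
  rintro ⟨b, l⟩ hl h
  obtain ⟨f, hf⟩ := hu.exists_isCutting
  obtain ⟨m, rfl⟩ := Nat.exists_eq_add_of_le' (show 2 ≤ k by omega)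
  obtain ⟨j, h₁, hz₁, h₂, hz₂, ha⟩ := h.exists_forall_square (by omega)
  obtain ⟨n, -, hr₁, hs₁⟩ := hf.exists_run (by omega) m fun t ht => h₁ t (by omega)
  obtain ⟨p, hp, hr₂, hs₂⟩ := hf.exists_run (by omega) m fun t ht => h₂ t (by omega)
  obtain ⟨q, hq, ⟨-, h1⟩ | ⟨hl₁, hq'⟩⟩ := hf.eq_of_zero (by omega) hz₁
  · have h0 := h₂ 0 (by omega)
    rw [add_zero, ← add_assoc, h1] at h0
    simp at h0
  obtain rfl : q = n + (m + 1) := hf.strictMono.injective (by omega)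
  obtain rfl : p = n + (m + 2) := hf.strictMono.injective (hp.symm.trans hq'.symm)
  obtain ⟨q, hq, hz⟩ := hf.eq_of_zero (by omega) hz₂
  obtain rfl : q = n + (m + 2) + (m + 1) := hf.strictMono.injective (by omega)
  have hrun : ∀ t ≤ m + 1, u (n + t) = (false, t) := fun t ht => by
    obtain rfl | ht := Nat.eq_or_lt_of_le ht
    · simpa using hl₁
    · exact hr₁ t (by omega)
  obtain ⟨h0, -⟩ | ⟨hl₂, hs⟩ := hz
  · exact absurd h0 (hf.not_runs_twin_zero (by omega) (by omega) hrun hr₂)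
  obtain _ | l := l
  · cases b
    · obtain ⟨q, hq, hz⟩ := hf.eq_of_zero (by omega) ha
      obtain rfl : q = n + (m + 2) + (m + 2) := hf.strictMono.injective (hq.symm.trans hs.symm)
      have hrun' : ∀ t ≤ m + 1, u (n + (m + 2) + t) = (false, t) := fun t ht => by
        obtain rfl | ht := Nat.eq_or_lt_of_le ht
        · simpa using hl₂
        · exact hr₂ t (by omega)
      obtain ⟨h0, -⟩ | ⟨h0, -⟩ := hz
      · exact absurd h0 (hf.not_runs_zero (by omega) (by omega) hrun hrun')
      · have := hf.eq_pred (l := m) (i := n + (m + 2) + (m + 1)) (by omega) (by omega) h0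
        simpa using hl₂.symm.trans this
    · rfl
  · have hpred := hf.eq_pred (i := j + (m + 2 + 1) + (m + 2)) (by omega) hl ha
    rw [hz₂, Prod.mk.injEq] at hpred
    obtain ⟨rfl, rfl⟩ := hpred
    obtain ⟨q, hq', h0, -⟩ := hf.eq_of_one (by omega) ha
    obtain rfl : q = n + (m + 2) + (m + 1) := hf.strictMono.injective (by omega)
    rw [h0] at hl₂
    simp at hl₂
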